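/- arXiv:2408.16819 — 2 statements merged into one kernel-verified Lean document; each statement's English description precedes it below -/
import Mathlib

section
/- Large-argument limit of the boosted generalized error function: let v₁,…,vₙ span a positive definite subspace of ℝᵈ (with respect to a bilinear form of signature (n₊,n₋), n ≤ n₊), and let x ∈ ℝᵈ. Then lim_{λ→∞} Φₙᴱ({vᵢ}; λx) = Σ_{J ⊆ {1,…,n}} Φ_{|J|}ᴱ({v_k}_{k∈J}; 0) · ∏_{k∈J} δ(v_k·x) · ∏_{i∉J} sgn(vᵢ·x), where δ(t)=1 if t=0 and 0 otherwise. In particular, if the set J₀ = {i : vᵢ·x = 0} is the set of vanishing products, the limit equals Φ_{|J₀|}ᴱ({v_a}_{a∈J₀};0) · ∏_{i∉J₀} sgn(vᵢ·x). -/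
open MeasureTheory Matrix
open scoped Classical

/-- The sign function with the convention `sgn 0 = 0`. -/
noncomputable def sgn (x : ℝ) : ℝ := if 0 < x then 1 else if x < 0 then -1 else 0

/-- The indicator function of `0`. -/
noncomputable def delta (x : ℝ) : ℝ := if x = 0 then 1 else 0

/-- The boosted generalized error function `Φₙᴱ({vᵢ};x)`, in its integral representation:
with `X` the Gram matrix `Xᵢⱼ = vᵢ·G·vⱼ` of the vectors `vᵢ` with respect to the bilinear
form given by `G`,
`Φₙᴱ({vᵢ};x) = (det X)^{−1/2} ∫ e^{−π (c−u)ᵀ X⁻¹ (c−u)} ∏ᵢ sgn(uᵢ) du`,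
where `cᵢ = vᵢ·G·x`.  For the empty family this equals `1` (the convention `Φ₀ᴱ = 1`). -/
noncomputable def PhiE {d : ℕ} (G : Matrix (Fin d) (Fin d) ℝ)
    {ι : Type} [Fintype ι] (v : ι → Fin d → ℝ) (x : Fin d → ℝ) : ℝ :=
  (Matrix.of fun i j : ι => v i ⬝ᵥ G.mulVec (v j)).det ^ (-(1:ℝ)/2) *
    ∫ u : ι → ℝ,
      Real.exp (-Real.pi *
        (((fun i => v i ⬝ᵥ G.mulVec x) - u) ⬝ᵥ
          (Matrix.of fun i j : ι => v i ⬝ᵥ G.mulVec (v j))⁻¹.mulVec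
            ((fun i => v i ⬝ᵥ G.mulVec x) - u))) *
      ∏ i, sgn (u i)

open scoped Matrix.Norms.L2Operator MatrixOrder in
theorem Matrix.PosDef.exists_eq_transpose_mul_self {ι : Type*} [Fintype ι] [DecidableEq ι]
    {M : Matrix ι ι ℝ} (hM : M.PosDef) : ∃ B : Matrix ι ι ℝ, M = Bᵀ * B ∧ B.det ≠ 0 := by
  obtain ⟨B, hB⟩ := CStarAlgebra.nonneg_iff_eq_star_mul_self.mp hM.posSemidef.nonneg
  rw [star_eq_conjTranspose, conjTranspose_eq_transpose_of_trivial] at hB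
  refine ⟨B, hB, fun h => ?_⟩
  have := hM.det_pos
  rw [hB, det_mul, h, mul_zero] at this
  exact this.false

theorem integrable_and_integral_exp_neg_pi_dotProduct_self (ι : Type*) [Fintype ι] :
    Integrable (fun w : ι → ℝ => Real.exp (-Real.pi * (w ⬝ᵥ w))) ∧
      ∫ w : ι → ℝ, Real.exp (-Real.pi * (w ⬝ᵥ w)) = 1 := by
  have h : (fun w : ι → ℝ => Real.exp (-Real.pi * (w ⬝ᵥ w))) =
      fun w => ∏ i, Real.exp (-Real.pi * w i ^ 2) := by
    funext w
    rw [← Real.exp_sum, dotProduct, Finset.mul_sum]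
    simp only [pow_two]
  rw [h]
  refine ⟨Integrable.fintype_prod (f := fun _ t => Real.exp (-Real.pi * t ^ 2))
    fun _ => integrable_exp_neg_mul_sq Real.pi_pos, ?_⟩
  rw [integral_fintype_prod_volume_eq_prod (fun (_ : ι) (t : ℝ) => Real.exp (-Real.pi * t ^ 2))]
  simp only [integral_gaussian, div_self Real.pi_ne_zero, Real.sqrt_one, Finset.prod_const_one]

theorem Matrix.PosDef.integrable_and_integral_exp_neg_pi {ι : Type*} [Fintype ι] [DecidableEq ι]
    {M : Matrix ι ι ℝ} (hM : M.PosDef) :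
    Integrable (fun w : ι → ℝ => Real.exp (-Real.pi * (w ⬝ᵥ M *ᵥ w))) ∧
      ∫ w : ι → ℝ, Real.exp (-Real.pi * (w ⬝ᵥ M *ᵥ w)) = M.det ^ (-(1 : ℝ) / 2) := by
  obtain ⟨B, rfl, hB⟩ := hM.exists_eq_transpose_mul_self
  have hq : (fun w : ι → ℝ => Real.exp (-Real.pi * (w ⬝ᵥ (Bᵀ * B) *ᵥ w))) =
      (fun w => Real.exp (-Real.pi * (w ⬝ᵥ w))) ∘ toLin' B := by
    funext w
    simp only [Function.comp, toLin'_apply, ← mulVec_mulVec]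
    rw [dotProduct_mulVec, vecMul_transpose]
  obtain ⟨hi, h1⟩ := integrable_and_integral_exp_neg_pi_dotProduct_self ι
  have hmap := Real.map_matrix_volume_pi_eq_smul_volume_pi hB
  have hmeas : AEMeasurable (toLin' B) (volume : Measure (ι → ℝ)) :=
    (LinearMap.continuous_of_finiteDimensional _).measurable.aemeasurable
  have hi' : Integrable (fun w : ι → ℝ => Real.exp (-Real.pi * (w ⬝ᵥ w)))
      (Measure.map (toLin' B) volume) := by
    rw [hmap]
    exact hi.smul_measure ENNReal.ofReal_ne_top
  rw [hq]
  refine ⟨hi'.comp_aemeasurable hmeas, ?_⟩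
  change ∫ w, (fun w : ι → ℝ => Real.exp (-Real.pi * (w ⬝ᵥ w))) (toLin' B w) = _
  rw [← integral_map hmeas hi'.aestronglyMeasurable, hmap, integral_smul_measure, h1,
    ENNReal.toReal_ofReal (abs_nonneg _), det_mul, det_transpose, smul_eq_mul, mul_one,
    ← abs_mul_abs_self, ← pow_two, ← Real.rpow_natCast, ← Real.rpow_mul (abs_nonneg _), abs_inv]
  norm_num [Real.rpow_neg_one]

/-- Integrating a Gaussian over the first block of variables leaves the Gaussian of the Schur
complement. -/
theorem integral_exp_neg_pi_fromBlocks {m n : Type*} [Fintype m] [Fintype n] [DecidableEq m]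
    {A : Matrix m m ℝ} {B : Matrix m n ℝ} {D : Matrix n n ℝ}
    (hM : (fromBlocks A B Bᴴ D).PosDef) {f : (n → ℝ) → ℝ} (hf : Measurable f) {C : ℝ}
    (hC : ∀ y, ‖f y‖ ≤ C) :
    ∫ u : m ⊕ n → ℝ, Real.exp (-Real.pi * (u ⬝ᵥ fromBlocks A B Bᴴ D *ᵥ u)) * f (u ∘ Sum.inr) =
      A.det ^ (-(1 : ℝ) / 2) *
        ∫ y : n → ℝ, Real.exp (-Real.pi * (y ⬝ᵥ (D - Bᴴ * A⁻¹ * B) *ᵥ y)) * f y := by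
  have hA : A.PosDef := hM.submatrix (e := Sum.inl) Sum.inl_injective
  let _ : Invertible A := hA.isUnit.invertible
  have hint : Integrable fun u : m ⊕ n → ℝ =>
      Real.exp (-Real.pi * (u ⬝ᵥ fromBlocks A B Bᴴ D *ᵥ u)) * f (u ∘ Sum.inr) := by
    refine hM.integrable_and_integral_exp_neg_pi.1.mul_bdd (c := C) ?_ (.of_forall fun u => hC _)
    exact (hf.comp (by fun_prop)).aestronglyMeasurable
  have hmp := volume_measurePreserving_sumPiEquivProdPi_symm (fun _ : m ⊕ n => ℝ)
  rw [← hmp.integrable_comp_emb (MeasurableEquiv.measurableEmbedding _)] at hint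
  rw [← hmp.integral_comp', Measure.volume_eq_prod]
  rw [Measure.volume_eq_prod] at hint
  erw [integral_prod_symm _ hint]
  rw [← integral_const_mul]
  congr 1
  funext y
  have key : ∀ x : m → ℝ,
      ((MeasurableEquiv.sumPiEquivProdPi fun _ : m ⊕ n => ℝ).symm (x, y)) = Sum.elim x y := by
    intro x
    funext i
    cases i <;> rfl
  have hs : ∀ x : m → ℝ, Sum.elim x y ⬝ᵥ fromBlocks A B Bᴴ D *ᵥ Sum.elim x y =
      (x + (A⁻¹ * B) *ᵥ y) ⬝ᵥ A *ᵥ (x + (A⁻¹ * B) *ᵥ y) +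
        y ⬝ᵥ (D - Bᴴ * A⁻¹ * B) *ᵥ y := by
    intro x
    have := schur_complement_eq₁₁ B D x y hA.1
    simpa only [star_trivial, ← dotProduct_mulVec] using this
  simp only [Function.comp_apply, key, hs, mul_add, Real.exp_add, Sum.elim_comp_inr]
  rw [integral_mul_const, integral_mul_const,
    integral_add_right_eq_self fun x => Real.exp (-Real.pi * (x ⬝ᵥ A *ᵥ x)),
    hA.integrable_and_integral_exp_neg_pi.2, mul_assoc]

theorem gaussian_marginal_sum {m n : Type*} [Fintype m] [Fintype n]
    [DecidableEq m] [DecidableEq n]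
    {X : Matrix (m ⊕ n) (m ⊕ n) ℝ} (hX : X.PosDef) {f : (n → ℝ) → ℝ} (hf : Measurable f) {C : ℝ}
    (hC : ∀ y, ‖f y‖ ≤ C) :
    X.det ^ (-(1 : ℝ) / 2) *
        ∫ u : m ⊕ n → ℝ, Real.exp (-Real.pi * (u ⬝ᵥ X⁻¹ *ᵥ u)) * f (u ∘ Sum.inr) =
      X.toBlocks₂₂.det ^ (-(1 : ℝ) / 2) *
        ∫ y : n → ℝ, Real.exp (-Real.pi * (y ⬝ᵥ X.toBlocks₂₂⁻¹ *ᵥ y)) * f y := by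
  obtain ⟨A, B, D, hM⟩ : ∃ A B D, X⁻¹ = fromBlocks A B Bᴴ D := by
    refine ⟨X⁻¹.toBlocks₁₁, X⁻¹.toBlocks₁₂, X⁻¹.toBlocks₂₂, ?_⟩
    conv_lhs => rw [← fromBlocks_toBlocks X⁻¹]
    congr 1
    ext i j
    exact (hX.inv.1.apply _ _).symm
  have hMp : (fromBlocks A B Bᴴ D).PosDef := hM ▸ hX.inv
  have hA : A.PosDef := hMp.submatrix (e := Sum.inl) Sum.inl_injective
  let _ : Invertible A := hA.isUnit.invertible
  let _ : Invertible (fromBlocks A B Bᴴ D) := hMp.isUnit.invertible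
  let _ : Invertible (D - Bᴴ * ⅟A * B) := invertibleOfFromBlocks₁₁Invertible A B Bᴴ D
  have hXM : X = ⅟(fromBlocks A B Bᴴ D) := by
    rw [invOf_eq_nonsing_inv, ← hM, nonsing_inv_nonsing_inv _ ((isUnit_iff_isUnit_det X).1 hX.isUnit)]
  have hX22 : X.toBlocks₂₂ = (D - Bᴴ * A⁻¹ * B)⁻¹ := by
    rw [hXM, invOf_fromBlocks₁₁_eq, toBlocks_fromBlocks₂₂, invOf_eq_nonsing_inv,
      invOf_eq_nonsing_inv]
  have hdet : X⁻¹.det = A.det * (D - Bᴴ * A⁻¹ * B).det := by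
    rw [hM, det_fromBlocks₁₁, invOf_eq_nonsing_inv]
  have hX22p : X.toBlocks₂₂.PosDef := hX.submatrix (e := Sum.inr) Sum.inr_injective
  have hS : (D - Bᴴ * A⁻¹ * B) = X.toBlocks₂₂⁻¹ := by
    rw [hX22, nonsing_inv_nonsing_inv]
    rw [← invOf_eq_nonsing_inv A]
    exact isUnit_det_of_invertible _
  rw [hS, det_nonsing_inv, det_nonsing_inv, Ring.inverse_eq_inv'] at hdet
  have hXdet : X.toBlocks₂₂.det = X.det * A.det := by
    have h1 := hX.det_pos.ne'
    have h2 := hX22p.det_pos.ne'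
    field_simp at hdet
    linarith
  rw [hM, integral_exp_neg_pi_fromBlocks hMp hf hC, hS, hXdet,
    Real.mul_rpow hX.det_pos.le hA.det_pos.le, mul_assoc]

/-- Marginals of a centred Gaussian: the covariance of a subfamily of the coordinates is the
corresponding principal submatrix. -/
theorem gaussian_marginal {ι : Type*} [Fintype ι] [DecidableEq ι] {X : Matrix ι ι ℝ} (hX : X.PosDef)
    (J : Finset ι) [DecidableEq {a // a ∈ J}] {f : ({a // a ∈ J} → ℝ) → ℝ} (hf : Measurable f) {C : ℝ}
    (hC : ∀ y, ‖f y‖ ≤ C) :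
    X.det ^ (-(1 : ℝ) / 2) *
        ∫ u : ι → ℝ, Real.exp (-Real.pi * (u ⬝ᵥ X⁻¹ *ᵥ u)) * f (fun k => u k) =
      (X.submatrix Subtype.val Subtype.val : Matrix {a // a ∈ J} {a // a ∈ J} ℝ).det
          ^ (-(1 : ℝ) / 2) *
        ∫ y : {a // a ∈ J} → ℝ, Real.exp (-Real.pi *
          (y ⬝ᵥ (X.submatrix Subtype.val Subtype.val)⁻¹ *ᵥ y)) * f y := by
  let e : {a // a ∉ J} ⊕ {a // a ∈ J} ≃ ι :=
    (Equiv.sumComm _ _).trans (Equiv.sumCompl fun a => a ∈ J)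
  have hXe : (X.submatrix e e).PosDef := hX.submatrix e.injective
  have h := gaussian_marginal_sum hXe hf hC
  have h22 : (X.submatrix e e).toBlocks₂₂ = X.submatrix Subtype.val Subtype.val := rfl
  rw [h22, det_submatrix_equiv_self] at h
  rw [← h]
  congr 1
  rw [← (volume_measurePreserving_piCongrLeft (fun _ : ι => ℝ) e).integral_comp']
  congr 1
  funext u
  have hu : ∀ i, MeasurableEquiv.piCongrLeft (fun _ : ι => ℝ) e u (e i) = u i := fun i =>
    Equiv.piCongrLeft_apply_apply (fun _ : ι => ℝ) e u i
  have hu' : MeasurableEquiv.piCongrLeft (fun _ : ι => ℝ) e u = u ∘ e.symm := by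
    funext i
    obtain ⟨i, rfl⟩ := e.surjective i
    simp [hu]
  have h1 : (fun k : {a // a ∈ J} => (u ∘ e.symm) k) = u ∘ Sum.inr := by
    funext k
    have : (k : ι) = e (Sum.inr k) := rfl
    simp [this]
  rw [hu', h1, inv_submatrix_equiv, submatrix_mulVec_equiv, ← comp_equiv_symm_dotProduct]

theorem norm_sgn_le_one (t : ℝ) : ‖sgn t‖ ≤ 1 := by
  unfold sgn
  split_ifs <;> simp

theorem measurable_sgn : Measurable sgn :=
  Measurable.ite measurableSet_Ioi measurable_const
    (Measurable.ite measurableSet_Iio measurable_const measurable_const)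

theorem norm_prod_sgn_le_one {ι : Type*} (s : Finset ι) (u : ι → ℝ) :
    ‖∏ i ∈ s, sgn (u i)‖ ≤ 1 := by
  rw [norm_prod]
  exact Finset.prod_le_one (fun _ _ => norm_nonneg _) fun _ _ => norm_sgn_le_one _

theorem measurable_prod_sgn {ι : Type*} (s : Finset ι) :
    Measurable fun u : ι → ℝ => ∏ i ∈ s, sgn (u i) :=
  Finset.measurable_fun_prod s fun i _ => measurable_sgn.comp (measurable_pi_apply i)

theorem tendsto_sgn_mul_add_atTop (c w : ℝ) :
    Filter.Tendsto (fun l : ℝ => sgn (l * c + w)) Filter.atTop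
      (nhds (if c = 0 then sgn w else sgn c)) := by
  rcases lt_trichotomy c 0 with hc | rfl | hc
  · rw [if_neg hc.ne]
    refine tendsto_const_nhds.congr' ?_
    filter_upwards [((Filter.tendsto_id.atTop_mul_const_of_neg hc).atBot_add
      (tendsto_const_nhds (x := w))).eventually_lt_atBot 0] with l hl
    simp only [id] at hl
    simp [sgn, hl, hc, hl.not_gt, hc.not_gt]
  · simp
  · rw [if_neg hc.ne']
    refine tendsto_const_nhds.congr' ?_
    filter_upwards [((Filter.tendsto_id.atTop_mul_const hc).atTop_add
      (tendsto_const_nhds (x := w))).eventually_gt_atTop 0] with l hl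
    simp only [id] at hl
    simp [sgn, hl, hc]

theorem PhiE_smul_eq {d : ℕ} (G : Matrix (Fin d) (Fin d) ℝ) {ι : Type} [Fintype ι]
    (v : ι → Fin d → ℝ) (x : Fin d → ℝ) (l : ℝ) :
    PhiE G v (l • x) =
      (Matrix.of fun i j : ι => v i ⬝ᵥ G.mulVec (v j)).det ^ (-(1 : ℝ) / 2) *
        ∫ w : ι → ℝ, Real.exp (-Real.pi *
          (w ⬝ᵥ (Matrix.of fun i j : ι => v i ⬝ᵥ G.mulVec (v j))⁻¹ *ᵥ w)) *
          ∏ i, sgn (l * (v i ⬝ᵥ G.mulVec x) + w i) := by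
  unfold PhiE
  congr 1
  rw [← integral_add_left_eq_self _ fun i => v i ⬝ᵥ G.mulVec (l • x)]
  congr 1
  funext w
  simp [mulVec_smul, mulVec_neg]

theorem tendsto_PhiE_smul_atTop {d : ℕ} (G : Matrix (Fin d) (Fin d) ℝ) {ι : Type} [Fintype ι]
    (v : ι → Fin d → ℝ) (x : Fin d → ℝ)
    (hpd : (Matrix.of fun i j : ι => v i ⬝ᵥ G.mulVec (v j)).PosDef)
    (J : Finset ι) (hJ : ∀ i, i ∈ J ↔ v i ⬝ᵥ G.mulVec x = 0) :
    Filter.Tendsto (fun l : ℝ => PhiE G v (l • x)) Filter.atTop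
      (nhds (PhiE G (fun k : {a : ι // a ∈ J} => v k.1) (0 : Fin d → ℝ) *
        ∏ i ∈ Jᶜ, sgn (v i ⬝ᵥ G.mulVec x))) := by
  let _ : DecidableEq {a // a ∈ J} := fun a b => Classical.propDecidable (a = b)
  have hmarg := gaussian_marginal hpd J (measurable_prod_sgn Finset.univ)
    (norm_prod_sgn_le_one Finset.univ)
  have h0 := PhiE_smul_eq G (fun k : {a : ι // a ∈ J} => v k.1) 0 0
  simp only [smul_zero, zero_mul, zero_add] at h0
  have hsub : (Matrix.of fun i j : {a // a ∈ J} => v i ⬝ᵥ G.mulVec (v j)) =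
      (Matrix.of fun i j : ι => v i ⬝ᵥ G.mulVec (v j)).submatrix Subtype.val Subtype.val := rfl
  rw [h0, hsub, ← hmarg, mul_assoc, ← integral_mul_const]
  simp only [PhiE_smul_eq]
  refine Filter.Tendsto.const_mul _ ?_
  have hgi := hpd.inv.integrable_and_integral_exp_neg_pi.1
  refine tendsto_integral_filter_of_dominated_convergence _ (.of_forall fun l => ?_)
    (.of_forall fun l => .of_forall fun w => ?_) hgi (.of_forall fun w => ?_)
  · exact hgi.aestronglyMeasurable.mul
      ((measurable_prod_sgn Finset.univ).comp (by fun_prop)).aestronglyMeasurable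
  · rw [norm_mul, Real.norm_of_nonneg (Real.exp_pos _).le]
    exact mul_le_of_le_one_right (Real.exp_pos _).le (norm_prod_sgn_le_one _ _)
  · rw [mul_assoc]
    refine Filter.Tendsto.const_mul _ ?_
    have hprod : (∏ k : {a // a ∈ J}, sgn (w k)) * ∏ i ∈ Jᶜ, sgn (v i ⬝ᵥ G.mulVec x) =
        ∏ i, if v i ⬝ᵥ G.mulVec x = 0 then sgn (w i) else sgn (v i ⬝ᵥ G.mulVec x) := by
      rw [← Finset.prod_mul_prod_compl J, Finset.prod_coe_sort J fun i => sgn (w i)]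
      congr 1 <;> refine Finset.prod_congr rfl fun i hi => ?_
      · rw [if_pos ((hJ i).1 hi)]
      · rw [if_neg (mt (hJ i).2 (Finset.mem_compl.1 hi))]
    rw [hprod]
    exact tendsto_finsetProd _ fun i _ => tendsto_sgn_mul_add_atTop _ _

/-- Large-argument limit of the boosted generalized error function:
`lim_{λ→∞} Φₙᴱ({vᵢ}; λx) = Σ_{J ⊆ {1,…,n}} Φ_{|J|}ᴱ({v_k}_{k∈J}; 0) ∏_{k∈J} δ(v_k·x)
∏_{i∉J} sgn(vᵢ·x)`; in particular, with `J₀ = {i : vᵢ·x = 0}`, the limit equals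
`Φ_{|J₀|}ᴱ({v_a}_{a∈J₀};0) ∏_{i∉J₀} sgn(vᵢ·x)`. -/
theorem PhiE_large_argument_limit
    (d n : ℕ) (G : Matrix (Fin d) (Fin d) ℝ) (hG : G.IsSymm)
    (v : Fin n → Fin d → ℝ) (x : Fin d → ℝ)
    (hpd : (Matrix.of fun i j : Fin n => v i ⬝ᵥ G.mulVec (v j)).PosDef) :
    Filter.Tendsto (fun lam : ℝ => PhiE G v (lam • x)) Filter.atTop
      (nhds (∑ J : Finset (Fin n),
        PhiE G (fun k : {a : Fin n // a ∈ J} => v k.1) (0 : Fin d → ℝ) *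
          (∏ k ∈ J, delta (v k ⬝ᵥ G.mulVec x)) *
          ∏ i ∈ Jᶜ, sgn (v i ⬝ᵥ G.mulVec x))) ∧
    Filter.Tendsto (fun lam : ℝ => PhiE G v (lam • x)) Filter.atTop
      (nhds (PhiE G
          (fun k : {a : Fin n // a ∈ Finset.univ.filter fun i => v i ⬝ᵥ G.mulVec x = 0} =>
            v k.1) (0 : Fin d → ℝ) *
        ∏ i ∈ (Finset.univ.filter fun i => v i ⬝ᵥ G.mulVec x = 0)ᶜ,
          sgn (v i ⬝ᵥ G.mulVec x))) := by
  set J₀ := Finset.univ.filter fun i => v i ⬝ᵥ G.mulVec x = 0 with hJ₀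
  have hmem : ∀ i, i ∈ J₀ ↔ v i ⬝ᵥ G.mulVec x = 0 := fun i => by simp [hJ₀]
  have hlim : Filter.Tendsto (fun lam : ℝ => PhiE G v (lam • x)) Filter.atTop
      (nhds (PhiE G (fun k : {a : Fin n // a ∈ J₀} => v k.1) (0 : Fin d → ℝ) *
        ∏ i ∈ J₀ᶜ, sgn (v i ⬝ᵥ G.mulVec x))) := by
    convert tendsto_PhiE_smul_atTop G v x hpd J₀ hmem
  refine ⟨?_, by convert hlim⟩
  rw [Finset.sum_eq_single J₀]
  · rwa [Finset.prod_eq_one fun k hk => by simp [delta, (hmem k).1 hk], mul_one]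
  · intro J _ hJ
    by_cases hsub : J ⊆ J₀
    · obtain ⟨i, hi, hiJ⟩ := Finset.exists_of_ssubset (hsub.ssubset_of_ne hJ)
      rw [Finset.prod_eq_zero (Finset.mem_compl.2 hiJ) (by simp [(hmem i).1 hi, sgn]), mul_zero]
    · obtain ⟨k, hk, hkJ⟩ := Finset.not_subset.1 hsub
      rw [Finset.prod_eq_zero hk (by simp [delta, mt (hmem k).2 hkJ]), mul_zero, zero_mul]
  · simp
end

section
/- Signature of the difference quadratic form: let κ_{ab} be a symmetric integer matrix of signature (1, b₂−1), and suppose κ = Σᵢ₌₁ⁿ κᵢ where each κᵢ is symmetric of signature (1, b₂−1) and invertible over ℚ. Then the quadratic form Q_n(q₁,…,qₙ) = qᵀκ^{−1}q − Σᵢ qᵢᵀκᵢ^{−1}qᵢ, restricted to the hyperplane Σᵢ qᵢ = q with q fixed (a space of dimension (n−1)b₂), has signature ((n−1)(b₂−1), n−1). -/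
open Matrix

/-- The linear map sending `(q₁,…,qₙ)` to `Σᵢ qᵢ`. -/
noncomputable def sumMap (n b₂ : ℕ) : (Fin n → Fin b₂ → ℝ) →ₗ[ℝ] (Fin b₂ → ℝ) where
  toFun r := ∑ i, r i
  map_add' := by intro x y; simp [Finset.sum_add_distrib]
  map_smul' := by intro c x; simp [Finset.smul_sum]

/-- The form `x ↦ x ⬝ᵥ A *ᵥ x` is negative definite on the kernel of some linear map to `ℝᵏ`,
i.e. on a subspace of codimension at most `k`. -/
def NegDefOffRank {b : ℕ} (A : Matrix (Fin b) (Fin b) ℝ) (k : ℕ) : Prop :=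
  ∃ φ : (Fin b → ℝ) →ₗ[ℝ] (Fin k → ℝ), ∀ x, φ x = 0 → x ≠ 0 → x ⬝ᵥ A *ᵥ x < 0

theorem negDefOffRank_of_diagonalization {b k : ℕ} {A U : Matrix (Fin b) (Fin b) ℝ}
    {d : Fin b → ℝ} (hU : ∀ x, U *ᵥ x = 0 → x = 0)
    (hA : ∀ x, x ⬝ᵥ A *ᵥ x = ∑ j, d j * (U *ᵥ x) j ^ 2) (hd : ∀ j, d j ≠ 0)
    (hk : (Finset.univ.filter fun j => 0 < d j).card = k) : NegDefOffRank A k := by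
  let e : Fin k ≃ {j // j ∈ Finset.univ.filter fun j => 0 < d j} :=
    (Finset.equivFinOfCardEq hk).symm
  refine ⟨(LinearMap.funLeft ℝ ℝ fun i => (e i : Fin b)) ∘ₗ U.mulVecLin, fun x hx hx0 => ?_⟩
  have hpos : ∀ j, 0 < d j → (U *ᵥ x) j = 0 := by
    intro j hj
    have := congrFun hx (e.symm ⟨j, by simpa using hj⟩)
    simpa [LinearMap.funLeft_apply] using this
  rw [hA]
  have hle : ∀ j, d j * (U *ᵥ x) j ^ 2 ≤ 0 := by
    intro j
    rcases lt_or_ge 0 (d j) with h | h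
    · simp [hpos j h]
    · exact mul_nonpos_of_nonpos_of_nonneg h (sq_nonneg _)
  obtain ⟨j, hj⟩ : ∃ j, (U *ᵥ x) j ≠ 0 := by
    by_contra! h
    exact hx0 (hU x (funext h))
  refine Finset.sum_neg' (fun j _ => hle j) ⟨j, Finset.mem_univ _, lt_of_le_of_ne (hle j) ?_⟩
  exact mul_ne_zero (hd j) (pow_ne_zero 2 hj)

theorem Matrix.IsHermitian.exists_diagonalization {b : ℕ} {A : Matrix (Fin b) (Fin b) ℝ}
    (hA : A.IsHermitian) : ∃ U : Matrix (Fin b) (Fin b) ℝ, (∀ x, U *ᵥ x = 0 → x = 0) ∧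
      ∀ x, x ⬝ᵥ A *ᵥ x = ∑ j, hA.eigenvalues j * (U *ᵥ x) j ^ 2 := by
  let V : Matrix (Fin b) (Fin b) ℝ := hA.eigenvectorUnitary
  have hV : V * Vᵀ = 1 := by
    have := Unitary.coe_mul_star_self hA.eigenvectorUnitary
    simpa [V, star_eq_conjTranspose] using this
  have hAV : A = V * diagonal hA.eigenvalues * Vᵀ := by
    have := hA.spectral_theorem
    rw [Unitary.conjStarAlgAut_apply] at this
    simpa [V, star_eq_conjTranspose] using! this
  refine ⟨Vᵀ, fun x hx => ?_, fun x => ?_⟩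
  · rw [← one_mulVec x, ← hV, ← mulVec_mulVec, hx, mulVec_zero]
  · have : x ⬝ᵥ A *ᵥ x = (Vᵀ *ᵥ x) ⬝ᵥ diagonal hA.eigenvalues *ᵥ (Vᵀ *ᵥ x) := by
      conv_lhs => rw [hAV]
      rw [← mulVec_mulVec, ← mulVec_mulVec, dotProduct_mulVec, ← mulVec_transpose]
    rw [this]
    simp only [dotProduct, mulVec_diagonal]
    exact Finset.sum_congr rfl fun j _ => by ring

theorem Matrix.IsHermitian.negDefOffRank_of_signature {b k l : ℕ} {A : Matrix (Fin b) (Fin b) ℝ}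
    (hA : A.IsHermitian) (hdet : A.det ≠ 0)
    (hk : (Finset.univ.filter fun j => 0 < hA.eigenvalues j).card = k)
    (hl : (Finset.univ.filter fun j => hA.eigenvalues j < 0).card = l) :
    NegDefOffRank A k ∧ NegDefOffRank (-A) l := by
  obtain ⟨U, hU, hAU⟩ := hA.exists_diagonalization
  have hd : ∀ j, hA.eigenvalues j ≠ 0 := by
    rw [hA.det_eq_prod_eigenvalues] at hdet
    simpa [Finset.prod_ne_zero_iff] using hdet
  refine ⟨negDefOffRank_of_diagonalization hU hAU hd hk,
    negDefOffRank_of_diagonalization (d := -hA.eigenvalues) hU (fun x => ?_) (by simpa using hd)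
      (by simpa using hl)⟩
  simp [neg_mulVec, hAU]

theorem Matrix.IsHermitian.det_ne_zero_of_signature {b k l : ℕ} {A : Matrix (Fin b) (Fin b) ℝ}
    (hA : A.IsHermitian)
    (hk : (Finset.univ.filter fun j => 0 < hA.eigenvalues j).card = k)
    (hl : (Finset.univ.filter fun j => hA.eigenvalues j < 0).card = l) (hkl : k + l = b) :
    A.det ≠ 0 := by
  rw [hA.det_eq_prod_eigenvalues]
  have hdisj : Disjoint (Finset.univ.filter fun j => 0 < hA.eigenvalues j)
      (Finset.univ.filter fun j => hA.eigenvalues j < 0) :=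
    Finset.disjoint_filter.2 fun j _ h => h.not_gt
  have huniv := Finset.eq_univ_of_card _
    ((Finset.card_union_of_disjoint hdisj).trans (by simp [hk, hl, hkl]))
  refine Finset.prod_ne_zero_iff.2 fun j _ => ?_
  have := huniv ▸ Finset.mem_univ j
  simp only [Finset.mem_union, Finset.mem_filter, Finset.mem_univ, true_and] at this
  rcases this with h | h
  · simpa using h.ne'
  · simpa using h.ne

/-- The bilinear form `(r, s) ↦ ∑ i, r i ⬝ᵥ (A i)⁻¹ *ᵥ s i`. -/
noncomputable def sumInvForm {n b : ℕ} (A : Fin n → Matrix (Fin b) (Fin b) ℝ) :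
    LinearMap.BilinForm ℝ (Fin n → Fin b → ℝ) :=
  LinearMap.mk₂ ℝ (fun r s => ∑ i, r i ⬝ᵥ (A i)⁻¹ *ᵥ s i)
    (by intros; simp [Finset.sum_add_distrib])
    (by intros; simp [Finset.mul_sum])
    (by intros; simp [mulVec_add, Finset.sum_add_distrib])
    (by intros; simp [mulVec_smul, Finset.mul_sum])

theorem sumInvForm_apply {n b : ℕ} (A : Fin n → Matrix (Fin b) (Fin b) ℝ)
    (r s : Fin n → Fin b → ℝ) :
    sumInvForm A r s = ∑ i, r i ⬝ᵥ (A i)⁻¹ *ᵥ s i := rfl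

theorem sumInvForm_neg {n b : ℕ} {A : Fin n → Matrix (Fin b) (Fin b) ℝ}
    (hdet : ∀ i, IsUnit (A i).det) : sumInvForm (-A) = -sumInvForm A := by
  have h (i : Fin n) : (-A i)⁻¹ = -(A i)⁻¹ :=
    inv_eq_right_inv (by rw [neg_mul_neg, mul_nonsing_inv _ (hdet i)])
  ext r s
  simp [sumInvForm_apply, h, neg_mulVec]

theorem dotProduct_mulVec_comm_of_isSymm {b : ℕ} {A : Matrix (Fin b) (Fin b) ℝ} (hA : A.IsSymm)
    (x y : Fin b → ℝ) : x ⬝ᵥ A *ᵥ y = y ⬝ᵥ A *ᵥ x := by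
  rw [dotProduct_mulVec, ← mulVec_transpose, hA.eq, dotProduct_comm]

theorem sumInvForm_isSymm {n b : ℕ} {A : Fin n → Matrix (Fin b) (Fin b) ℝ}
    (hA : ∀ i, (A i).IsSymm) (r s : Fin n → Fin b → ℝ) : sumInvForm A r s = sumInvForm A s r := by
  rw [sumInvForm_apply, sumInvForm_apply]
  exact Finset.sum_congr rfl fun i _ => dotProduct_mulVec_comm_of_isSymm (hA i).inv _ _

theorem sum_eq_zero_of_mem_ker_sumMap {n b : ℕ} {r : Fin n → Fin b → ℝ}
    (hr : r ∈ LinearMap.ker (sumMap n b)) : ∑ i, r i = 0 := hr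

theorem finrank_add_le_of_nonneg {n b k l : ℕ} (hkl : k + l = b)
    {A : Fin n → Matrix (Fin b) (Fin b) ℝ} (hA : ∀ i, (A i).IsSymm)
    (hdet : ∀ i, IsUnit (A i).det) (hk : ∀ i, NegDefOffRank (A i) k)
    (hl : NegDefOffRank (-∑ i, A i) l) {W : Submodule ℝ (Fin n → Fin b → ℝ)}
    (hW : W ≤ LinearMap.ker (sumMap n b)) (hnn : ∀ r ∈ W, 0 ≤ sumInvForm A r r) :
    Module.finrank ℝ W + k ≤ n * k := by
  choose φ hφ using hk
  obtain ⟨χ, hχ⟩ := hl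
  have hker : k ≤ Module.finrank ℝ (LinearMap.ker χ) := by
    have h1 := χ.finrank_range_add_finrank_ker
    have h2 := (LinearMap.range χ).finrank_le
    simp only [Module.finrank_fin_fun] at h1 h2
    omega
  let x : (W × LinearMap.ker χ) →ₗ[ℝ] (Fin n → Fin b → ℝ) := LinearMap.pi fun i =>
    (A i)⁻¹.mulVecLin ∘ₗ LinearMap.proj i ∘ₗ W.subtype ∘ₗ LinearMap.fst ℝ _ _ +
      (LinearMap.ker χ).subtype ∘ₗ LinearMap.snd ℝ _ _
  have hx (w v i) : x (w, v) i = (A i)⁻¹ *ᵥ (w : Fin n → Fin b → ℝ) i + (v : Fin b → ℝ) := rfl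
  let f : (W × LinearMap.ker χ) →ₗ[ℝ] (Fin n → Fin k → ℝ) :=
    LinearMap.pi fun i => φ i ∘ₗ LinearMap.proj i ∘ₗ x
  have hf : Function.Injective f := by
    rw [← LinearMap.ker_eq_bot, LinearMap.ker_eq_bot']
    rintro ⟨w, v⟩ hwv
    have hφx (i) : φ i (x (w, v) i) = 0 := congrFun hwv i
    have hle (i) : x (w, v) i ⬝ᵥ A i *ᵥ x (w, v) i ≤ 0 := by
      by_cases h : x (w, v) i = 0
      · simp [h]
      · exact (hφ i _ (hφx i) h).le
    have hAx (i) : A i *ᵥ x (w, v) i = w.1 i + A i *ᵥ v.1 := by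
      rw [hx, mulVec_add, mulVec_mulVec, mul_nonsing_inv _ (hdet i), one_mulVec]
    have hterm (i) : x (w, v) i ⬝ᵥ A i *ᵥ x (w, v) i =
        w.1 i ⬝ᵥ (A i)⁻¹ *ᵥ w.1 i + 2 * (v.1 ⬝ᵥ w.1 i) + v.1 ⬝ᵥ A i *ᵥ v.1 := by
      have hcross : ((A i)⁻¹ *ᵥ w.1 i) ⬝ᵥ A i *ᵥ v.1 = v.1 ⬝ᵥ w.1 i := by
        rw [dotProduct_mulVec_comm_of_isSymm (hA i), mulVec_mulVec, mul_nonsing_inv _ (hdet i),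
          one_mulVec]
      rw [hAx, hx, add_dotProduct, dotProduct_add, dotProduct_add, hcross,
        dotProduct_comm _ (w.1 i)]
      ring
    have hsum : ∑ i, x (w, v) i ⬝ᵥ A i *ᵥ x (w, v) i =
        sumInvForm A w.1 w.1 + v.1 ⬝ᵥ (∑ i, A i) *ᵥ v.1 := by
      simp_rw [hterm, Finset.sum_add_distrib, ← Finset.mul_sum, ← dotProduct_sum,
        sum_eq_zero_of_mem_ker_sumMap (hW w.2), sumInvForm_apply, sum_mulVec, dotProduct_sum]
      simp
    have hnp : ∑ i, x (w, v) i ⬝ᵥ A i *ᵥ x (w, v) i ≤ 0 := Finset.sum_nonpos fun i _ => hle i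
    have hv : v.1 = 0 := by
      by_contra h
      have := hχ v.1 v.2 h
      rw [neg_mulVec, dotProduct_neg] at this
      linarith [hnn w.1 w.2]
    have h0 : ∑ i, x (w, v) i ⬝ᵥ A i *ᵥ x (w, v) i = 0 := by
      refine le_antisymm hnp ?_
      rw [hsum, hv]
      simpa using hnn w.1 w.2
    have hx0 (i) : x (w, v) i = 0 := by
      by_contra h
      exact (hφ i _ (hφx i) h).ne
        ((Finset.sum_eq_zero_iff_of_nonpos fun i _ => hle i).1 h0 i (Finset.mem_univ i))
    have hw : w.1 = 0 := funext fun i => by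
      have := hAx i
      rw [hx0, hv] at this
      simpa using this.symm
    exact Prod.ext (Subtype.ext hw) (Subtype.ext hv)
  have := LinearMap.finrank_le_finrank_of_injective hf
  rw [Module.finrank_prod, Module.finrank_pi_fintype] at this
  simp only [Module.finrank_fin_fun, Finset.sum_const, Finset.card_univ, Fintype.card_fin,
    smul_eq_mul] at this
  omega

theorem finrank_ker_sumMap {n : ℕ} (hn : 1 ≤ n) (b : ℕ) :
    Module.finrank ℝ (LinearMap.ker (sumMap n b)) = (n - 1) * b := by
  have hsurj : LinearMap.range (sumMap n b) = ⊤ := by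
    rw [LinearMap.range_eq_top]
    exact fun v => ⟨Pi.single ⟨0, hn⟩ v, by simp [sumMap]⟩
  have h := (sumMap n b).finrank_range_add_finrank_ker
  rw [hsurj, finrank_top, Module.finrank_fin_fun, Module.finrank_pi_fintype] at h
  simp only [Module.finrank_fin_fun, Finset.sum_const, Finset.card_univ, Fintype.card_fin,
    smul_eq_mul] at h
  rw [Nat.sub_mul]
  omega

theorem eq_zero_of_sumInvForm_eq_zero {n b : ℕ} {A : Fin n → Matrix (Fin b) (Fin b) ℝ}
    (hA : ∀ i, (A i).IsSymm) (hdet : ∀ i, IsUnit (A i).det) (hdet' : IsUnit (∑ i, A i).det)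
    {r : Fin n → Fin b → ℝ} (hr : r ∈ LinearMap.ker (sumMap n b))
    (h : ∀ s ∈ LinearMap.ker (sumMap n b), sumInvForm A r s = 0) : r = 0 := by
  have hconst (i j) : (A i)⁻¹ *ᵥ r i = (A j)⁻¹ *ᵥ r j := by
    refine dotProduct_eq _ _ fun e => ?_
    have hs : Pi.single i e - Pi.single j e ∈ LinearMap.ker (sumMap n b) := by
      simp [sumMap]
    have := h _ hs
    rw [sumInvForm_isSymm hA, map_sub, LinearMap.sub_apply, sub_eq_zero] at this
    have hsingle (i) : sumInvForm A (Pi.single i e) r = e ⬝ᵥ (A i)⁻¹ *ᵥ r i := by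
      rw [sumInvForm_apply, Finset.sum_eq_single i]
      · simp
      · intro j _ hj
        simp [hj]
      · simp
    rwa [hsingle, hsingle, dotProduct_comm, dotProduct_comm e] at this
  have hinv (i) : A i *ᵥ (A i)⁻¹ *ᵥ r i = r i := by
    rw [mulVec_mulVec, mul_nonsing_inv _ (hdet i), one_mulVec]
  funext i
  have hzero : (∑ j, A j) *ᵥ (A i)⁻¹ *ᵥ r i = 0 := by
    rw [sum_mulVec, ← sum_eq_zero_of_mem_ker_sumMap hr]
    exact Finset.sum_congr rfl fun j _ => by rw [hconst i j, hinv]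
  rw [← hinv i, ← one_mulVec ((A i)⁻¹ *ᵥ r i), ← nonsing_inv_mul _ hdet', ← mulVec_mulVec, hzero]
  simp

theorem isGreatest_finrank_posDef_sumInvForm {n b k l : ℕ} (hn : 1 ≤ n) (hkl : k + l = b)
    {A : Fin n → Matrix (Fin b) (Fin b) ℝ} (hA : ∀ i, (A i).IsSymm)
    (hdet : ∀ i, IsUnit (A i).det) (hdet' : IsUnit (∑ i, A i).det)
    (hk : ∀ i, NegDefOffRank (A i) k) (hl : ∀ i, NegDefOffRank (-A i) l)
    (hk' : NegDefOffRank (∑ i, A i) k) (hl' : NegDefOffRank (-∑ i, A i) l) :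
    IsGreatest {d : ℕ | ∃ W : Submodule ℝ (Fin n → Fin b → ℝ),
      W ≤ LinearMap.ker (sumMap n b) ∧ Module.finrank ℝ W = d ∧
      ∀ r ∈ W, r ≠ 0 → 0 < sumInvForm A r r} ((n - 1) * k) := by
  have hnonneg {B : LinearMap.BilinForm ℝ (Fin n → Fin b → ℝ)}
      {W : Submodule ℝ (Fin n → Fin b → ℝ)} (h : ∀ r ∈ W, r ≠ 0 → 0 < B r r) :
      ∀ r ∈ W, 0 ≤ B r r := by
    intro r hr
    by_cases h0 : r = 0
    · simp [h0]
    · exact (h r hr h0).le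
  let K := LinearMap.ker (sumMap n b)
  let Q : QuadraticForm ℝ K := (sumInvForm A).toQuadraticMap.comp K.subtype
  have hQ (r : K) : Q r = sumInvForm A r r := rfl
  obtain ⟨P, hP, hPpos⟩ := exists_finrank_eq_sigPos_and_posDef Q
  obtain ⟨N, hN, hNneg⟩ := exists_finrank_eq_sigNeg_and_negDef Q
  have hPpos' : ∀ r ∈ P.map K.subtype, r ≠ 0 → 0 < sumInvForm A r r := by
    rintro _ ⟨r, hr, rfl⟩ h0
    exact hPpos ⟨r, hr⟩ fun h => h0 (by simpa using congrArg Subtype.val h)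
  have hNneg' : ∀ r ∈ N.map K.subtype, r ≠ 0 → 0 < sumInvForm (-A) r r := by
    rintro _ ⟨r, hr, rfl⟩ h0
    rw [sumInvForm_neg hdet]
    exact hNneg ⟨r, hr⟩ fun h => h0 (by simpa using congrArg Subtype.val h)
  have hPle := finrank_add_le_of_nonneg hkl hA hdet hk hl' (K.map_subtype_le P) (hnonneg hPpos')
  have hNle := finrank_add_le_of_nonneg (A := -A) ((add_comm l k).trans hkl) (fun i => (hA i).neg)
    (fun i => by simpa [det_neg] using hdet i) hl (by simpa using hk')
    (K.map_subtype_le N) (hnonneg hNneg')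
  have hrad : Q.radical = ⊥ := by
    refine (Submodule.eq_bot_iff _).2 fun r hr => Subtype.ext ?_
    refine eq_zero_of_sumInvForm_eq_zero hA hdet hdet' r.2 fun s hs => ?_
    obtain ⟨hr0, hr1⟩ := QuadraticMap.mem_radical_iff'.1 hr
    have h := hr1 ⟨s, hs⟩
    simp only [hQ] at hr0 h
    simp only [Submodule.coe_add, map_add, LinearMap.add_apply, hr0,
      sumInvForm_isSymm hA s r] at h
    linarith
  have hsum := QuadraticForm.sigPos_add_sigNeg_add_radical (Q := Q)
  rw [hrad, finrank_bot, finrank_ker_sumMap hn] at hsum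
  rw [Submodule.finrank_map_subtype_eq] at hPle hNle
  refine ⟨⟨P.map K.subtype, K.map_subtype_le P, ?_, hPpos'⟩, ?_⟩
  · rw [Submodule.finrank_map_subtype_eq]
    obtain ⟨m, rfl⟩ := Nat.exists_eq_add_of_le' hn
    subst hkl
    simp only [Nat.add_sub_cancel] at *
    linarith
  · rintro _ ⟨W, hW, rfl, hpos⟩
    have := finrank_add_le_of_nonneg hkl hA hdet hk hl' hW (hnonneg hpos)
    rw [Nat.sub_mul]
    omega

/-- Signature of the difference quadratic form: let `κᵢ` (`i = 1,…,n`) be symmetric real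
matrices of signature `(1, b₂−1)` (one positive and `b₂−1` negative eigenvalues),
invertible, with sum `κ = Σᵢ κᵢ` also symmetric of signature `(1, b₂−1)`.  Consider
`Q_n(q₁,…,qₙ) = qᵀκ⁻¹q − Σᵢ qᵢᵀκᵢ⁻¹qᵢ` restricted to the affine hyperplane
`Σᵢ qᵢ = q` (with `q` fixed), a space of dimension `(n−1)·b₂`, and let `B` be its
quadratic part around any base point `p₀` of the hyperplane,
`B(r) = (Q_n(p₀+r) + Q_n(p₀−r) − 2 Q_n(p₀))/2` for `r` with `Σᵢ rᵢ = 0`.  Then the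
maximal dimension of a subspace of `{Σᵢ rᵢ = 0}` on which `B` is positive definite is
`(n−1)(b₂−1)` and the maximal dimension of one on which it is negative definite is
`n−1`; i.e. the restricted form has signature `((n−1)(b₂−1), n−1)`. -/
theorem signature_of_Qn
    (b₂ n : ℕ) (hb : 1 ≤ b₂) (hn : 1 ≤ n)
    (κi : Fin n → Matrix (Fin b₂) (Fin b₂) ℝ)
    (hherm : ∀ i, (κi i).IsHermitian)
    (hunit : ∀ i, IsUnit (κi i).det)
    (hsig : ∀ i,
      (Finset.univ.filter fun j => 0 < (hherm i).eigenvalues j).card = 1 ∧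
      (Finset.univ.filter fun j => (hherm i).eigenvalues j < 0).card = b₂ - 1)
    (κ : Matrix (Fin b₂) (Fin b₂) ℝ) (hκ : κ = ∑ i, κi i)
    (hκherm : κ.IsHermitian)
    (hκsig : (Finset.univ.filter fun j => 0 < hκherm.eigenvalues j).card = 1 ∧
      (Finset.univ.filter fun j => hκherm.eigenvalues j < 0).card = b₂ - 1)
    (q : Fin b₂ → ℝ)
    (Qn : (Fin n → Fin b₂ → ℝ) → ℝ)
    (hQn : Qn = fun p => q ⬝ᵥ κ⁻¹.mulVec q - ∑ i, (p i) ⬝ᵥ (κi i)⁻¹.mulVec (p i)) :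
    Module.finrank ℝ (LinearMap.ker (sumMap n b₂)) = (n - 1) * b₂ ∧
    ∀ p₀ : Fin n → Fin b₂ → ℝ, sumMap n b₂ p₀ = q →
      (sSup {dm : ℕ | ∃ W : Submodule ℝ (Fin n → Fin b₂ → ℝ),
          W ≤ LinearMap.ker (sumMap n b₂) ∧ Module.finrank ℝ W = dm ∧
          ∀ r ∈ W, r ≠ 0 →
            0 < (Qn (p₀ + r) + Qn (p₀ - r) - 2 * Qn p₀) / 2} = (n - 1) * (b₂ - 1) ∧
       sSup {dm : ℕ | ∃ W : Submodule ℝ (Fin n → Fin b₂ → ℝ),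
          W ≤ LinearMap.ker (sumMap n b₂) ∧ Module.finrank ℝ W = dm ∧
          ∀ r ∈ W, r ≠ 0 →
            (Qn (p₀ + r) + Qn (p₀ - r) - 2 * Qn p₀) / 2 < 0} = n - 1) := by
  have hQn' (p r : Fin n → Fin b₂ → ℝ) :
      (Qn (p + r) + Qn (p - r) - 2 * Qn p) / 2 = -sumInvForm κi r r := by
    have h (x : Fin n → Fin b₂ → ℝ) : Qn x = q ⬝ᵥ κ⁻¹ *ᵥ q - sumInvForm κi x x := by
      rw [hQn, sumInvForm_apply]
    simp only [h, map_add, map_sub, LinearMap.add_apply, LinearMap.sub_apply]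
    ring
  have hsymm (i : Fin n) : (κi i).IsSymm := by simpa [IsHermitian, IsSymm] using hherm i
  have hdet := hκherm.det_ne_zero_of_signature hκsig.1 hκsig.2 (by omega)
  have hrank (i : Fin n) :=
    (hherm i).negDefOffRank_of_signature (hunit i).ne_zero (hsig i).1 (hsig i).2
  obtain ⟨hκ₁, hκ₂⟩ := hκherm.negDefOffRank_of_signature hdet hκsig.1 hκsig.2
  rw [hκ] at hdet hκ₁ hκ₂
  have hpos := isGreatest_finrank_posDef_sumInvForm (A := -κi) hn (Nat.sub_add_cancel hb)
    (fun i => (hsymm i).neg) (fun i => by simpa [det_neg] using hunit i)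
    (by simpa [det_neg] using hdet) (fun i => (hrank i).2) (fun i => by simpa using (hrank i).1)
    (by simpa using hκ₂) (by simpa using hκ₁)
  have hneg := isGreatest_finrank_posDef_sumInvForm hn (Nat.add_sub_cancel' hb)
    hsymm hunit hdet.isUnit (fun i => (hrank i).1) (fun i => (hrank i).2) hκ₁ hκ₂
  refine ⟨finrank_ker_sumMap hn b₂, fun p₀ _ => ⟨?_, ?_⟩⟩
  · simpa only [hQn', sumInvForm_neg hunit, LinearMap.neg_apply] using hpos.csSup_eq
  · simpa only [hQn', neg_lt_zero, mul_one] using hneg.csSup_eq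
end
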